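/- Under assumptions (A2)–(A8) below, the value function satisfies the two-term large-time expansion v(T,x,z) = T·v̄ + v_f(x) + v_b(z) + o(1) as T → +∞; equivalently, lim_{T→+∞} ( v(T,x,z) − T·v̄ ) = v_f(x) + v_b(z). -/

import Mathlib

open MeasureTheory Filter Topology Metric Set

noncomputable section

/-- Euclidean state/control spaces. -/
abbrev Euc (n : ℕ) := EuclideanSpace ℝ (Fin n)

/-- An admissible pair `(y,u)` on `[0,T]` for the dynamics `f` with control constraint set `Ω`:
`u` is measurable, `Ω`-valued a.e. on `[0,T]`, and `y t = y 0 + ∫₀ᵗ f (y s) (u s) ds` on `[0,T]`. -/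
def IsAdmissible {n p : ℕ} (f : Euc n → Euc p → Euc n) (Ω : Set (Euc p)) (T : ℝ)
    (y : ℝ → Euc n) (u : ℝ → Euc p) : Prop :=
  Measurable u ∧ (∀ᵐ t ∂(volume.restrict (Icc (0:ℝ) T)), u t ∈ Ω) ∧
  ∀ t ∈ Icc (0:ℝ) T, y t = y 0 + ∫ s in (0:ℝ)..t, f (y s) (u s)

/-- An admissible pair `(y,u)` on `[0,∞)` for the dynamics `f`. -/
def IsAdmissibleInf {n p : ℕ} (f : Euc n → Euc p → Euc n) (Ω : Set (Euc p))
    (y : ℝ → Euc n) (u : ℝ → Euc p) : Prop :=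
  Measurable u ∧ (∀ᵐ t ∂(volume.restrict (Ici (0:ℝ))), u t ∈ Ω) ∧
  ∀ t, 0 ≤ t → y t = y 0 + ∫ s in (0:ℝ)..t, f (y s) (u s)

/-- A class-K function: continuous, (strictly) increasing on `[0,∞)`, nonnegative, vanishing at `0`. -/
def IsClassK (α : ℝ → ℝ) : Prop :=
  ContinuousOn α (Ici 0) ∧ StrictMonoOn α (Ici 0) ∧ α 0 = 0 ∧ ∀ s ∈ Ici (0:ℝ), 0 ≤ α s

/-- Strict dissipativity at `(ȳ,ū)` with supply rate `w`, (bounded) storage function `S` and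
class-K function `α`. -/
def StrictlyDissipative {n p : ℕ} (f : Euc n → Euc p → Euc n) (Ω : Set (Euc p))
    (w : Euc n → Euc p → ℝ) (ybar : Euc n) (ubar : Euc p)
    (S : Euc n → ℝ) (α : ℝ → ℝ) : Prop :=
  (∃ M, ∀ x, |S x| ≤ M) ∧ IsClassK α ∧
  ∀ T > (0:ℝ), ∀ y u, IsAdmissible f Ω T y u →
    S (y T) + ∫ t in (0:ℝ)..T, α ‖(y t - ybar, u t - ubar)‖ ≤
      S (y 0) + ∫ t in (0:ℝ)..T, w (y t) (u t)

/-- The value function `v(T,x,z)` of the finite-horizon problem. -/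
def valueFn {n p : ℕ} (f : Euc n → Euc p → Euc n) (f0 : Euc n → Euc p → ℝ)
    (Ω : Set (Euc p)) (T : ℝ) (x z : Euc n) : ℝ :=
  sInf {c | ∃ y u, IsAdmissible f Ω T y u ∧ y 0 = x ∧ y T = z ∧
    c = ∫ t in (0:ℝ)..T, f0 (y t) (u t)}

/-- The value of the shifted infinite-horizon problem with dynamics `f`, running cost `w`
and initial state `x` (the cost of an admissible pair is the limit of its partial costs). -/
def vInf {n p : ℕ} (f : Euc n → Euc p → Euc n) (Ω : Set (Euc p))
    (w : Euc n → Euc p → ℝ) (x : Euc n) : ℝ :=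
  sInf {c | ∃ y u, IsAdmissibleInf f Ω y u ∧ y 0 = x ∧
    Tendsto (fun T => ∫ t in (0:ℝ)..T, w (y t) (u t)) atTop (𝓝 c)}

/-- Times at which `ybar` can be reached from `x` by an admissible pair for `f`. -/
def reachTimes {n p : ℕ} (f : Euc n → Euc p → Euc n) (Ω : Set (Euc p))
    (x ybar : Euc n) : Set ℝ :=
  {t | 0 ≤ t ∧ ∃ y u, IsAdmissible f Ω t y u ∧ y 0 = x ∧ y t = ybar}

/-- The minimum time to reach `ybar` from `x` with the dynamics `f`. -/
def minTime {n p : ℕ} (f : Euc n → Euc p → Euc n) (Ω : Set (Euc p))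
    (x ybar : Euc n) : ℝ :=
  sInf (reachTimes f Ω x ybar)


section Trajectories

variable {n p : ℕ} {f : Euc n → Euc p → Euc n} {Ω : Set (Euc p)}

/-- An admissible pair on `[0,T]`, `0 ≤ T`, whose velocity is integrable. -/
structure IsTrajectory (f : Euc n → Euc p → Euc n) (Ω : Set (Euc p)) (T : ℝ)
    (y : ℝ → Euc n) (u : ℝ → Euc p) : Prop where
  nonneg : 0 ≤ T
  admissible : IsAdmissible f Ω T y u
  integrable : IntervalIntegrable (fun s => f (y s) (u s)) volume 0 T

/-- The curve equal to `a` before time `τ` and to the translate of `b` from time `τ` on. -/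
def concat {E : Type*} (τ : ℝ) (a b : ℝ → E) : ℝ → E := fun t => if t < τ then a t else b (t - τ)

lemma concat_of_lt {E : Type*} {τ t : ℝ} (a b : ℝ → E) (h : t < τ) : concat τ a b t = a t :=
  if_pos h

lemma concat_of_le {E : Type*} {τ t : ℝ} (a b : ℝ → E) (h : τ ≤ t) :
    concat τ a b t = b (t - τ) :=
  if_neg h.not_gt

lemma concat_of_le_left {E : Type*} {τ t : ℝ} {a b : ℝ → E} (hab : a τ = b 0) (h : t ≤ τ) :
    concat τ a b t = a t := by
  rcases h.lt_or_eq with h | rfl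
  · exact concat_of_lt a b h
  · rw [concat_of_le a b le_rfl, sub_self, hab]

variable {y y₁ y₂ : ℝ → Euc n} {u u₁ u₂ : ℝ → Euc p} {T T₁ T₂ : ℝ}

lemma IsAdmissible.mono (h : IsAdmissible f Ω T y u) {t : ℝ} (ht : t ≤ T) :
    IsAdmissible f Ω t y u :=
  ⟨h.1, ae_mono (Measure.restrict_mono (Icc_subset_Icc_right ht) le_rfl) h.2.1,
    fun s hs => h.2.2 s ⟨hs.1, hs.2.trans ht⟩⟩

lemma isAdmissibleInf_iff_forall :
    IsAdmissibleInf f Ω y u ↔ ∀ T, 0 ≤ T → IsAdmissible f Ω T y u := by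
  constructor
  · rintro ⟨hm, hΩ, hy⟩ T -
    exact ⟨hm, ae_mono (Measure.restrict_mono Icc_subset_Ici_self le_rfl) hΩ,
      fun t ht => hy t ht.1⟩
  · intro h
    refine ⟨(h 0 le_rfl).1, ?_, fun t ht => (h t ht).2.2 t ⟨ht, le_rfl⟩⟩
    have key : ∀ k : ℕ, ∀ᵐ t ∂(volume : Measure ℝ), t ∈ Icc (0 : ℝ) k → u t ∈ Ω := fun k =>
      (ae_restrict_iff' measurableSet_Icc).1 (h k k.cast_nonneg).2.1
    rw [ae_restrict_iff' measurableSet_Ici]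
    filter_upwards [ae_all_iff.2 key] with t ht ht0
    obtain ⟨k, hk⟩ := exists_nat_ge t
    exact ht k ⟨ht0, hk⟩

lemma IsTrajectory.mono (h : IsTrajectory f Ω T y u) {t : ℝ} (ht : t ∈ Icc 0 T) :
    IsTrajectory f Ω t y u := by
  refine ⟨ht.1, h.admissible.mono ht.2, h.integrable.mono_set ?_⟩
  rw [uIcc_of_le ht.1, uIcc_of_le h.nonneg]
  exact Icc_subset_Icc_right ht.2

lemma IsTrajectory.ae_mem (h : IsTrajectory f Ω T y u) :
    ∀ᵐ t ∂(volume : Measure ℝ), t ∈ Icc (0 : ℝ) T → u t ∈ Ω :=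
  (ae_restrict_iff' measurableSet_Icc).1 h.admissible.2.1

lemma IsTrajectory.continuousOn (h : IsTrajectory f Ω T y u) : ContinuousOn y (Icc 0 T) := by
  have h1 := intervalIntegral.continuousOn_primitive_interval
    ((intervalIntegrable_iff' (by finiteness)).1 h.integrable)
  rw [uIcc_of_le h.nonneg] at h1
  exact (continuousOn_const.add h1).congr h.admissible.2.2

lemma intervalIntegrable_comp_of_continuousOn {E : Type*} [NormedAddCommGroup E]
    [SecondCountableTopology E]
    {φ : Euc n → Euc p → E} (hφ : Continuous (Function.uncurry φ)) (hΩ : IsCompact Ω) {K : Set (Euc n)}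
    (hK : IsCompact K) (hT : 0 ≤ T) (hy : AEStronglyMeasurable y (volume.restrict (Icc 0 T)))
    (hyK : ∀ t ∈ Icc 0 T, y t ∈ K)
    (hu : Measurable u) (huΩ : ∀ᵐ t ∂(volume.restrict (Icc (0:ℝ) T)), u t ∈ Ω) :
    IntervalIntegrable (fun t => φ (y t) (u t)) volume 0 T := by
  obtain ⟨C, hC⟩ := (hK.prod hΩ).exists_bound_of_continuousOn hφ.continuousOn
  rw [intervalIntegrable_iff_integrableOn_Icc_of_le hT]
  refine IntegrableOn.of_bound measure_Icc_lt_top ?_ C ?_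
  · exact hφ.comp_aestronglyMeasurable (hy.prodMk hu.aestronglyMeasurable)
  · filter_upwards [huΩ, ae_restrict_mem measurableSet_Icc] with t ht ht'
    exact hC (y t, u t) ⟨hyK t ht', ht⟩

lemma IsTrajectory.intervalIntegrable (h : IsTrajectory f Ω T y u) (hΩ : IsCompact Ω)
    {E : Type*} [NormedAddCommGroup E] [SecondCountableTopology E]
    {φ : Euc n → Euc p → E} (hφ : Continuous (Function.uncurry φ)) :
    IntervalIntegrable (fun t => φ (y t) (u t)) volume 0 T :=
  intervalIntegrable_comp_of_continuousOn hφ hΩ (isCompact_Icc.image_of_continuousOn h.continuousOn)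
    h.nonneg (h.continuousOn.aestronglyMeasurable measurableSet_Icc)
    (fun _ ht => mem_image_of_mem y ht) h.admissible.1 h.admissible.2.1

/-- A bounded admissible curve cannot use the convention that a non-integrable function has
integral zero: its velocity is integrable. -/
lemma IsAdmissible.isTrajectory_of_bounded (h : IsAdmissible f Ω T y u) (hT : 0 ≤ T)
    (hf : Continuous (Function.uncurry f)) (hΩ : IsCompact Ω) {a : Euc n} {B : ℝ}
    (hB : ∀ t ∈ Icc 0 T, ‖y t - a‖ ≤ B) : IsTrajectory f Ω T y u := by
  refine ⟨hT, h, ?_⟩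
  set F : ℝ → Euc n := fun s => f (y s) (u s) with hF
  set A : Set ℝ := {t | t ∈ Icc 0 T ∧ IntervalIntegrable F volume 0 t} with hA
  have h0A : (0 : ℝ) ∈ A := ⟨⟨le_rfl, hT⟩, IntervalIntegrable.refl⟩
  have hbdd : BddAbove A := ⟨T, fun t ht => ht.1.2⟩
  set s := sSup A with hs
  have hs0 : 0 ≤ s := le_csSup hbdd h0A
  have hsT : s ≤ T := csSup_le ⟨0, h0A⟩ fun t ht => ht.1.2
  have hcont : ContinuousOn y (Ico 0 s) := by
    intro t ht
    obtain ⟨a, ha, hta⟩ := exists_lt_of_lt_csSup ⟨0, h0A⟩ ht.2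
    have hc : ContinuousOn y (Icc 0 a) :=
      IsTrajectory.continuousOn (f := f) (Ω := Ω) (u := u) ⟨ha.1.1, h.mono ha.1.2, ha.2⟩
    refine (hc t ⟨ht.1, hta.le⟩).mono_of_mem_nhdsWithin ?_
    filter_upwards [self_mem_nhdsWithin, mem_nhdsWithin_of_mem_nhds (Iio_mem_nhds hta)] with x hx hxa
    exact ⟨hx.1, le_of_lt hxa⟩
  have hconst : EqOn (fun _ => y 0) y (Ioc s T) := by
    intro t ht
    have : ¬ IntervalIntegrable F volume 0 t := fun hi =>
      (le_csSup hbdd ⟨⟨hs0.trans ht.1.le, ht.2⟩, hi⟩).not_gt ht.1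
    have h1 := h.2.2 t ⟨hs0.trans ht.1.le, ht.2⟩
    rw [intervalIntegral.integral_undef this, add_zero] at h1
    exact h1.symm
  have hmeas : AEStronglyMeasurable y (volume.restrict (Icc 0 T)) := by
    have hsub : Icc 0 T ⊆ (Ico 0 s ∪ {s}) ∪ Ioc s T := by
      intro t ht
      rcases lt_trichotomy t s with h | h | h
      · exact Or.inl (Or.inl ⟨ht.1, h⟩)
      · exact Or.inl (Or.inr h)
      · exact Or.inr ⟨h, ht.2⟩
    refine AEStronglyMeasurable.mono_measure ?_ (Measure.restrict_mono hsub le_rfl)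
    rw [aestronglyMeasurable_union_iff, aestronglyMeasurable_union_iff]
    refine ⟨⟨hcont.aestronglyMeasurable measurableSet_Ico, ?_⟩, ?_⟩
    · rw [Measure.restrict_eq_zero.2 (by simp)]
      exact aestronglyMeasurable_zero_measure y
    · exact (continuousOn_const.congr hconst.symm).aestronglyMeasurable measurableSet_Ioc
  exact intervalIntegrable_comp_of_continuousOn hf hΩ (isCompact_closedBall a B) hT hmeas
    (fun t ht => by simpa [dist_eq_norm] using hB t ht) h.1 h.2.1

lemma IsTrajectory.eq_add_integral (h : IsTrajectory f Ω T y u) {s t : ℝ} (hs : s ∈ Icc 0 T)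
    (ht : t ∈ Icc 0 T) : y t = y s + ∫ r in s..t, f (y r) (u r) := by
  rw [h.admissible.2.2 t ht, h.admissible.2.2 s hs, add_assoc,
    intervalIntegral.integral_add_adjacent_intervals (h.mono hs).integrable
      ((h.mono hs).integrable.symm.trans (h.mono ht).integrable)]

lemma IsTrajectory.congr (h : IsTrajectory f Ω T y u) (hy : EqOn y y₁ (Icc 0 T))
    (hu : EqOn u u₁ (Ico 0 T)) (hm : Measurable u₁) : IsTrajectory f Ω T y₁ u₁ := by
  have hF : EqOn (fun s => f (y s) (u s)) (fun s => f (y₁ s) (u₁ s)) (Ioo 0 T) := by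
    intro s hs
    simp only [hy (Ioo_subset_Icc_self hs), hu (Ioo_subset_Ico_self hs)]
  refine ⟨h.nonneg, ⟨hm, ?_, fun t ht => ?_⟩, ?_⟩
  · rw [← Measure.restrict_congr_set Ico_ae_eq_Icc, ae_restrict_iff' measurableSet_Ico]
    filter_upwards [h.ae_mem] with t ht ht'
    rw [← hu ht']
    exact ht (Ico_subset_Icc_self ht')
  · rw [← hy ht, ← hy ⟨le_rfl, h.nonneg⟩, h.admissible.2.2 t ht]
    congr 1
    refine intervalIntegral.integral_congr_uIoo (hF.mono ?_)
    rw [uIoo_of_le ht.1]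
    exact Ioo_subset_Ioo_right ht.2
  · refine h.integrable.congr_uIoo ?_
    rwa [uIoo_of_le h.nonneg]

lemma IsTrajectory.shift (h : IsTrajectory f Ω T y u) {s : ℝ} (hs : s ∈ Icc 0 T) :
    IsTrajectory f Ω (T - s) (fun t => y (s + t)) (fun t => u (s + t)) := by
  refine ⟨sub_nonneg.2 hs.2, ⟨h.admissible.1.comp (measurable_const_add s), ?_, fun t ht => ?_⟩, ?_⟩
  · rw [ae_restrict_iff' measurableSet_Icc]
    filter_upwards [(measurePreserving_add_left volume s).quasiMeasurePreserving.tendsto_ae.eventually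
      h.ae_mem] with t ht ht'
    exact ht ⟨add_nonneg hs.1 ht'.1, by linarith [ht'.2]⟩
  · have h1 := intervalIntegral.integral_comp_add_left (a := 0) (b := t)
      (fun r => f (y r) (u r)) s
    simp only at h1 ⊢
    rw [h1, add_zero]
    exact h.eq_add_integral hs ⟨add_nonneg hs.1 ht.1, by linarith [ht.2]⟩
  · have h1 := ((h.mono hs).integrable.symm.trans h.integrable).comp_add_left s
    simpa using h1

lemma IsTrajectory.reverse (h : IsTrajectory f Ω T y u) :
    IsTrajectory (fun a b => -f a b) Ω T (fun t => y (T - t)) (fun t => u (T - t)) := by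
  refine ⟨h.nonneg, ⟨h.admissible.1.comp (measurable_const.sub measurable_id), ?_, fun t ht => ?_⟩, ?_⟩
  · rw [ae_restrict_iff' measurableSet_Icc]
    filter_upwards [(Measure.measurePreserving_sub_left volume T).quasiMeasurePreserving.tendsto_ae.eventually
      h.ae_mem] with t ht ht'
    exact ht ⟨by linarith [ht'.2], by linarith [ht'.1]⟩
  · have h1 := intervalIntegral.integral_comp_sub_left (a := 0) (b := t)
      (fun r => f (y r) (u r)) T
    simp only [intervalIntegral.integral_neg] at h1 ⊢
    rw [h1, sub_zero, ← intervalIntegral.integral_symm]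
    exact h.eq_add_integral ⟨h.nonneg, le_rfl⟩ ⟨by linarith [ht.2], by linarith [ht.1]⟩
  · have h1 := (h.integrable.comp_sub_left T).symm
    rw [sub_self, sub_zero] at h1
    exact h1.neg

lemma isTrajectory_const {a : Euc n} {v : Euc p} (hv : v ∈ Ω) (hfa : f a v = 0) (hT : 0 ≤ T) :
    IsTrajectory f Ω T (fun _ => a) (fun _ => v) := by
  refine ⟨hT, ⟨measurable_const, .of_forall fun _ => hv, fun t _ => by simp [hfa]⟩, by simp⟩

lemma integral_concat_left {E : Type*} [NormedAddCommGroup E] [NormedSpace ℝ E]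
    (φ : Euc n → Euc p → E) {t : ℝ} (ht : t ∈ Icc 0 T₁) :
    ∫ s in 0..t, φ (concat T₁ y₁ y₂ s) (concat T₁ u₁ u₂ s) = ∫ s in 0..t, φ (y₁ s) (u₁ s) := by
  refine intervalIntegral.integral_congr_uIoo fun s hs => ?_
  rw [uIoo_of_le ht.1] at hs
  have := hs.2.trans_le ht.2
  simp only [concat_of_lt _ _ this]

lemma integral_concat_shift {E : Type*} [NormedAddCommGroup E] [NormedSpace ℝ E]
    (φ : Euc n → Euc p → E) {t : ℝ} (ht : 0 ≤ t) :
    ∫ s in T₁..T₁ + t, φ (concat T₁ y₁ y₂ s) (concat T₁ u₁ u₂ s) =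
      ∫ s in 0..t, φ (y₂ s) (u₂ s) := by
  have h1 := intervalIntegral.integral_comp_sub_right (a := T₁) (b := T₁ + t)
    (fun r => φ (y₂ r) (u₂ r)) T₁
  rw [sub_self, add_sub_cancel_left] at h1
  rw [← h1]
  refine intervalIntegral.integral_congr fun s hs => ?_
  rw [uIcc_of_le (by linarith)] at hs
  simp only [concat_of_le _ _ hs.1]

lemma intervalIntegrable_concat_left {E : Type*} [NormedAddCommGroup E]
    (φ : Euc n → Euc p → E) (hT : 0 ≤ T₁)
    (h : IntervalIntegrable (fun s => φ (y₁ s) (u₁ s)) volume 0 T₁) :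
    IntervalIntegrable (fun s => φ (concat T₁ y₁ y₂ s) (concat T₁ u₁ u₂ s)) volume 0 T₁ := by
  refine h.congr_uIoo fun s hs => ?_
  rw [uIoo_of_le hT] at hs
  simp only [concat_of_lt _ _ hs.2]

lemma intervalIntegrable_concat_right {E : Type*} [NormedAddCommGroup E]
    (φ : Euc n → Euc p → E) {t : ℝ} (ht : 0 ≤ t)
    (h : IntervalIntegrable (fun s => φ (y₂ s) (u₂ s)) volume 0 t) :
    IntervalIntegrable (fun s => φ (concat T₁ y₁ y₂ s) (concat T₁ u₁ u₂ s)) volume T₁ (T₁ + t) := by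
  have h1 := h.comp_sub_right T₁
  rw [zero_add, add_comm t] at h1
  refine h1.congr fun s hs => ?_
  rw [uIoc_of_le (by linarith)] at hs
  simp only [concat_of_le _ _ hs.1.le]

lemma IsTrajectory.concat (h₁ : IsTrajectory f Ω T₁ y₁ u₁) (h₂ : IsTrajectory f Ω T₂ y₂ u₂)
    (h : y₁ T₁ = y₂ 0) : IsTrajectory f Ω (T₁ + T₂) (concat T₁ y₁ y₂) (concat T₁ u₁ u₂) := by
  have hi₁ := intervalIntegrable_concat_left (y₂ := y₂) (u₂ := u₂) f h₁.nonneg h₁.integrable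
  have hi₂ : ∀ t ∈ Icc 0 T₂, _ := fun t ht => intervalIntegrable_concat_right (T₁ := T₁)
    (y₁ := y₁) (u₁ := u₁) f ht.1 (h₂.mono ht).integrable
  refine ⟨add_nonneg h₁.nonneg h₂.nonneg, ⟨?_, ?_, fun t ht => ?_⟩,
    hi₁.trans (hi₂ T₂ ⟨h₂.nonneg, le_rfl⟩)⟩
  · exact Measurable.ite measurableSet_Iio h₁.admissible.1
      (h₂.admissible.1.comp (measurable_id.sub measurable_const))
  · rw [ae_restrict_iff' measurableSet_Icc]
    filter_upwards [h₁.ae_mem, (measurePreserving_sub_right volume T₁).quasiMeasurePreserving.tendsto_ae.eventually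
      h₂.ae_mem] with t ht1 ht2 ht
    rcases lt_or_ge t T₁ with hlt | hle
    · rw [concat_of_lt _ _ hlt]
      exact ht1 ⟨ht.1, hlt.le⟩
    · rw [concat_of_le _ _ hle]
      exact ht2 ⟨by linarith, by linarith [ht.2]⟩
  · rw [concat_of_le_left h h₁.nonneg]
    rcases le_total t T₁ with hle | hle
    · rw [integral_concat_left f ⟨ht.1, hle⟩, concat_of_le_left h hle]
      exact h₁.admissible.2.2 t ⟨ht.1, hle⟩
    · obtain ⟨s, rfl⟩ : ∃ s, t = T₁ + s := ⟨t - T₁, by ring⟩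
      have hs : s ∈ Icc 0 T₂ := ⟨by linarith, by linarith [ht.2]⟩
      rw [← intervalIntegral.integral_add_adjacent_intervals hi₁ (hi₂ s hs),
        integral_concat_left f ⟨h₁.nonneg, le_rfl⟩, integral_concat_shift f hs.1,
        concat_of_le _ _ (by linarith), add_sub_cancel_left, h₂.admissible.2.2 s hs, ← h,
        h₁.admissible.2.2 T₁ ⟨h₁.nonneg, le_rfl⟩, add_assoc]

lemma IsTrajectory.integral_concat (h₁ : IsTrajectory f Ω T₁ y₁ u₁)
    (h₂ : IsTrajectory f Ω T₂ y₂ u₂) (hΩ : IsCompact Ω)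
    {w : Euc n → Euc p → ℝ} (hw : Continuous (Function.uncurry w)) {t : ℝ} (ht : t ∈ Icc 0 T₂) :
    ∫ s in 0..T₁ + t, w (_root_.concat T₁ y₁ y₂ s) (_root_.concat T₁ u₁ u₂ s) =
      (∫ s in 0..T₁, w (y₁ s) (u₁ s)) + ∫ s in 0..t, w (y₂ s) (u₂ s) := by
  rw [← intervalIntegral.integral_add_adjacent_intervals
    (intervalIntegrable_concat_left w h₁.nonneg (h₁.intervalIntegrable hΩ hw))
    (intervalIntegrable_concat_right w ht.1 ((h₂.mono ht).intervalIntegrable hΩ hw)),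
    integral_concat_left w ⟨h₁.nonneg, le_rfl⟩, integral_concat_shift w ht.1]

end Trajectories

section Loops

lemma exists_greedy_expansion {b : ℕ → ℝ} (hb : ∀ j, 0 < b j) (hb0 : Tendsto b atTop (𝓝 0))
    {κ : ℝ} (hκ : 0 < κ) :
    ∃ (j : ℕ → ℕ) (s : ℕ → Bool), Tendsto j atTop atTop ∧
      Tendsto (fun k => ∑ i ∈ Finset.range k, if s i then b (j i) else 0) atTop (𝓝 κ) := by
  let step : ℝ × ℕ → ℝ × ℕ := fun q => if b q.2 ≤ q.1 then (q.1 - b q.2, q.2) else (q.1, q.2 + 1)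
  let q : ℕ → ℝ × ℕ := fun k => step^[k] (κ, 0)
  have hq : ∀ k, q (k + 1) = step (q k) := fun k => Function.iterate_succ_apply' step k _
  have hpos : ∀ k, b (q k).2 ≤ (q k).1 → q (k + 1) = ((q k).1 - b (q k).2, (q k).2) := fun k h => by
    rw [hq]; exact if_pos h
  have hneg : ∀ k, ¬ b (q k).2 ≤ (q k).1 → q (k + 1) = ((q k).1, (q k).2 + 1) := fun k h => by
    rw [hq]; exact if_neg h
  have hnonneg : ∀ k, 0 ≤ (q k).1 := by
    intro k
    induction k with
    | zero => exact hκ.le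
    | succ k ih =>
      by_cases h : b (q k).2 ≤ (q k).1
      · rw [hpos k h]; exact sub_nonneg.2 h
      · rw [hneg k h]; exact ih
  have hinv : ∀ k m, (q k).2 = m + 1 → (q k).1 ≤ b m := by
    intro k
    induction k with
    | zero => intro m hm; exact absurd hm (by simp [q])
    | succ k ih =>
      intro m hm
      by_cases h : b (q k).2 ≤ (q k).1
      · rw [hpos k h] at hm ⊢
        linarith [ih m hm, hb (q k).2]
      · rw [hneg k h] at hm ⊢
        have : (q k).2 = m := Nat.succ_injective hm
        rw [← this]
        exact (not_le.1 h).le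
  have hmono : Monotone fun k => (q k).2 := by
    refine monotone_nat_of_le_succ fun k => ?_
    by_cases h : b (q k).2 ≤ (q k).1
    · rw [hpos k h]
    · rw [hneg k h]; exact Nat.le_succ _
  have hj : Tendsto (fun k => (q k).2) atTop atTop := by
    refine tendsto_atTop_atTop_of_monotone hmono fun m => ?_
    induction m with
    | zero => exact ⟨0, Nat.zero_le _⟩
    | succ m ih =>
      obtain ⟨k, hk⟩ := ih
      by_contra! hcon
      have heq : ∀ i, (q (k + i)).2 = m := fun i =>
        le_antisymm (Nat.lt_succ_iff.1 (hcon _)) (hk.trans (hmono (Nat.le_add_right k i)))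
      have hdec : ∀ i : ℕ, (q (k + i)).1 = (q k).1 - i * b m := by
        intro i
        induction i with
        | zero => simp
        | succ i ih =>
          have hle : b (q (k + i)).2 ≤ (q (k + i)).1 := by
            by_contra h
            have h1 := heq (i + 1)
            rw [← add_assoc, hneg _ h, heq i] at h1
            exact absurd h1 (Nat.succ_ne_self m)
          rw [← add_assoc, hpos _ hle, heq i, ih]
          push_cast
          ring
      obtain ⟨i, hi⟩ := exists_nat_gt ((q k).1 / b m)
      rw [div_lt_iff₀ (hb m)] at hi
      linarith [hnonneg (k + i), hdec i]
  refine ⟨fun k => (q k).2, fun k => decide (b (q k).2 ≤ (q k).1), hj, ?_⟩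
  have hsum : ∀ k, (∑ i ∈ Finset.range k,
      if decide (b (q i).2 ≤ (q i).1) then b (q i).2 else 0) = κ - (q k).1 := by
    intro k
    induction k with
    | zero => simp [q]
    | succ k ih =>
      rw [Finset.sum_range_succ, ih]
      by_cases h : b (q k).2 ≤ (q k).1
      · rw [hpos k h, if_pos (by simpa using h)]; ring
      · rw [hneg k h, if_neg (by simpa using h)]; ring
  have hR : Tendsto (fun k => (q k).1) atTop (𝓝 0) := by
    have h1 : Tendsto (fun k => b ((q k).2 - 1)) atTop (𝓝 0) :=
      hb0.comp ((tendsto_sub_atTop_nat 1).comp hj)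
    refine squeeze_zero' (.of_forall hnonneg) ?_ h1
    filter_upwards [hj.eventually_ge_atTop 1] with k hk
    exact hinv k _ (Nat.sub_add_cancel hk).symm
  simp only [hsum]
  simpa using hR.const_sub κ

variable {n p : ℕ} {f : Euc n → Euc p → Euc n} {Ω : Set (Euc p)}

/-- The curve following `Y k` on `[k, k + 1)`. -/
def glue {E : Type*} (Y : ℕ → ℝ → E) : ℝ → E := fun t => Y ⌊t⌋₊ (t - ⌊t⌋₊)

lemma glue_natCast_add {E : Type*} (Y : ℕ → ℝ → E) (k : ℕ) {s : ℝ} (hs : s ∈ Ico (0 : ℝ) 1) :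
    glue Y (k + s) = Y k s := by
  have : ⌊(k : ℝ) + s⌋₊ = k := by
    rw [Nat.floor_eq_iff (add_nonneg k.cast_nonneg hs.1)]
    exact ⟨by linarith [hs.1], by linarith [hs.2]⟩
  simp only [glue, this, add_sub_cancel_left]

lemma concat_glue {E : Type*} (Y : ℕ → ℝ → E) (k : ℕ) {t : ℝ} (ht : t < k + 1) :
    concat k (glue Y) (Y k) t = glue Y t := by
  rcases lt_or_ge t k with h | h
  · exact concat_of_lt _ _ h
  · rw [concat_of_le _ _ h, ← glue_natCast_add Y k ⟨by linarith, by linarith⟩, add_sub_cancel]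

lemma isTrajectory_glue {Y : ℕ → ℝ → Euc n} {U : ℕ → ℝ → Euc p} {a : Euc n}
    (h : ∀ k, IsTrajectory f Ω 1 (Y k) (U k)) (h0 : ∀ k, Y k 0 = a) (h1 : ∀ k, Y k 1 = a) (k : ℕ) :
    IsTrajectory f Ω k (glue Y) (glue U) := by
  have hm : Measurable (glue U) := by
    have hu : Measurable fun q : ℕ × ℝ => U q.1 q.2 :=
      measurable_from_prod_countable_right fun k => (h k).admissible.1
    have hfl : Measurable fun t : ℝ => ⌊t⌋₊ := Nat.measurable_floor
    exact hu.comp (hfl.prodMk (measurable_id.sub (measurable_from_nat.comp hfl)))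
  induction k with
  | zero =>
    rw [Nat.cast_zero]
    refine ⟨le_rfl, ⟨hm, ?_, fun t ht => ?_⟩, .refl⟩
    · rw [Icc_self, Measure.restrict_eq_zero.2 (by simp)]
      exact ae_zero.symm ▸ trivial
    · obtain rfl : t = 0 := le_antisymm ht.2 ht.1
      simp
  | succ k ih =>
    have hnat : ∀ m : ℕ, glue Y m = a := fun m => by simp [glue, h0]
    rw [Nat.cast_succ]
    refine (ih.concat (h k) ((hnat k).trans (h0 k).symm)).congr (fun t ht => ?_)
      (fun t ht => concat_glue U k ht.2) hm
    rcases ht.2.lt_or_eq with hlt | rfl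
    · exact concat_glue Y k hlt
    · rw [concat_of_le _ _ (by linarith), add_sub_cancel_left, h1, ← Nat.cast_succ, hnat]

lemma integral_glue {Y : ℕ → ℝ → Euc n} {U : ℕ → ℝ → Euc p} {a : Euc n}
    (h : ∀ k, IsTrajectory f Ω 1 (Y k) (U k)) (h0 : ∀ k, Y k 0 = a) (h1 : ∀ k, Y k 1 = a)
    (hΩ : IsCompact Ω) {w : Euc n → Euc p → ℝ} (hw : Continuous (Function.uncurry w))
    (k : ℕ) {s : ℝ} (hs : s ∈ Icc (0 : ℝ) 1) :
    ∫ t in 0..k + s, w (glue Y t) (glue U t) =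
      (∑ i ∈ Finset.range k, ∫ t in 0..1, w (Y i t) (U i t)) + ∫ t in 0..s, w (Y k t) (U k t) := by
  have key : ∀ (k : ℕ) {s : ℝ}, s ∈ Icc (0 : ℝ) 1 → ∫ t in 0..k + s, w (glue Y t) (glue U t) =
      (∫ t in 0..k, w (glue Y t) (glue U t)) + ∫ t in 0..s, w (Y k t) (U k t) := by
    intro k s hs
    rw [← (isTrajectory_glue h h0 h1 k).integral_concat (h k) hΩ hw hs]
    refine intervalIntegral.integral_congr_uIoo fun t ht => ?_
    rw [uIoo_of_le (add_nonneg k.cast_nonneg hs.1)] at ht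
    have : t < k + 1 := by linarith [ht.2, hs.2]
    simp only [concat_glue _ _ this]
  have hsum : ∀ k : ℕ, ∫ t in 0..k, w (glue Y t) (glue U t) =
      ∑ i ∈ Finset.range k, ∫ t in 0..1, w (Y i t) (U i t) := by
    intro k
    induction k with
    | zero => simp
    | succ k ih => rw [Nat.cast_succ, key k ⟨zero_le_one, le_rfl⟩, ih, Finset.sum_range_succ]
  rw [key k hs, hsum]

/-- If there are loops of duration one at the equilibrium, with arbitrarily small positive cost,
then every positive number is the cost of an infinite-horizon trajectory from the equilibrium. -/
lemma exists_cost_eq_of_loops {w : Euc n → Euc p → ℝ} (hw : Continuous (Function.uncurry w))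
    (hΩ : IsCompact Ω) {a : Euc n} {v : Euc p} (hv : v ∈ Ω) (hfa : f a v = 0) (hwa : w a v = 0)
    (hloop : ∀ ε > (0 : ℝ), ∃ y u, IsTrajectory f Ω 1 y u ∧ y 0 = a ∧ y 1 = a ∧
      0 < (∫ t in (0:ℝ)..1, w (y t) (u t)) ∧
      ∀ s ∈ Icc (0 : ℝ) 1, |∫ t in (0:ℝ)..s, w (y t) (u t)| ≤ ε) {κ : ℝ} (hκ : 0 < κ) :
    ∃ y u, (∀ T, 0 ≤ T → IsTrajectory f Ω T y u) ∧ y 0 = a ∧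
      Tendsto (fun T => ∫ t in (0:ℝ)..T, w (y t) (u t)) atTop (𝓝 κ) := by
  choose y u htraj h0 h1 hpos hsmall using fun j : ℕ => hloop (1 / ((j : ℝ) + 1)) (by positivity)
  have hlim : Tendsto (fun j : ℕ => 1 / ((j : ℝ) + 1)) atTop (𝓝 0) :=
    tendsto_one_div_add_atTop_nhds_zero_nat
  obtain ⟨j, s, hj, hs⟩ := exists_greedy_expansion hpos
    (squeeze_zero (fun j => (hpos j).le)
      (fun j => (le_abs_self _).trans (hsmall j 1 ⟨zero_le_one, le_rfl⟩)) hlim) hκ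
  let Y : ℕ → ℝ → Euc n := fun k => if s k then y (j k) else fun _ => a
  let U : ℕ → ℝ → Euc p := fun k => if s k then u (j k) else fun _ => v
  have hY : ∀ k, IsTrajectory f Ω 1 (Y k) (U k) := by
    intro k
    by_cases h : s k
    · simpa [Y, U, h] using htraj (j k)
    · simpa [Y, U, h] using isTrajectory_const hv hfa zero_le_one
  have hY0 : ∀ k, Y k 0 = a := fun k => by
    by_cases h : s k <;> simp [Y, h, h0]
  have hY1 : ∀ k, Y k 1 = a := fun k => by
    by_cases h : s k <;> simp [Y, h, h1]
  have hcost : ∀ k, ∫ t in 0..1, w (Y k t) (U k t) =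
      if s k then ∫ t in 0..1, w (y (j k) t) (u (j k) t) else 0 := fun k => by
    by_cases h : s k <;> simp [Y, U, h, hwa]
  have hpart : ∀ k, ∀ r ∈ Icc (0 : ℝ) 1,
      |∫ t in 0..r, w (Y k t) (U k t)| ≤ 1 / ((j k : ℝ) + 1) := fun k r hr => by
    by_cases h : s k
    · simpa [Y, U, h] using hsmall (j k) r hr
    · simp only [Y, U, h, Bool.false_eq_true, if_false, hwa, intervalIntegral.integral_zero, abs_zero]
      positivity
  refine ⟨glue Y, glue U, fun T hT => ?_, by simp [glue, hY0], ?_⟩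
  · obtain ⟨k, hk⟩ := exists_nat_ge T
    exact (isTrajectory_glue hY hY0 hY1 k).mono ⟨hT, hk⟩
  · have hfl : Tendsto (fun T : ℝ => ⌊T⌋₊) atTop atTop := tendsto_nat_floor_atTop
    have hrem : Tendsto (fun T : ℝ => ∫ t in 0..T - ⌊T⌋₊, w (Y ⌊T⌋₊ t) (U ⌊T⌋₊ t)) atTop (𝓝 0) := by
      refine squeeze_zero_norm' ?_ (hlim.comp (hj.comp hfl))
      filter_upwards [eventually_ge_atTop 0] with T hT
      exact hpart _ _ ⟨sub_nonneg.2 (Nat.floor_le hT), by linarith [Nat.lt_floor_add_one T]⟩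
    have hmain := (hs.comp hfl).add hrem
    rw [add_zero] at hmain
    refine hmain.congr' ?_
    filter_upwards [eventually_ge_atTop 0] with T hT
    have := integral_glue hY hY0 hY1 hΩ hw ⌊T⌋₊ (s := T - ⌊T⌋₊)
      ⟨sub_nonneg.2 (Nat.floor_le hT), by linarith [Nat.lt_floor_add_one T]⟩
    rw [add_sub_cancel] at this
    rw [this]
    simp only [Function.comp_apply, hcost]

end Loops

section Turnpike

variable {n p : ℕ} {f : Euc n → Euc p → Euc n} {Ω : Set (Euc p)} {w : Euc n → Euc p → ℝ}
  {ybar : Euc n} {ubar : Euc p} {T : ℝ} {y y₁ y₂ : ℝ → Euc n} {u u₁ u₂ : ℝ → Euc p}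

/-- There is a trajectory from `a` to `b` in time `T` whose cost is `c`. -/
def Steers (f : Euc n → Euc p → Euc n) (Ω : Set (Euc p)) (w : Euc n → Euc p → ℝ) (T : ℝ)
    (a b : Euc n) (c : ℝ) : Prop :=
  ∃ y u, IsTrajectory f Ω T y u ∧ y 0 = a ∧ y T = b ∧ ∫ t in (0:ℝ)..T, w (y t) (u t) = c

lemma Steers.trans (hw : Continuous (Function.uncurry w)) (hΩ : IsCompact Ω) {T₁ T₂ c₁ c₂ : ℝ}
    {a b d : Euc n} (h₁ : Steers f Ω w T₁ a b c₁) (h₂ : Steers f Ω w T₂ b d c₂) :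
    Steers f Ω w (T₁ + T₂) a d (c₁ + c₂) := by
  obtain ⟨y₁, u₁, ht₁, h₁0, h₁T, h₁c⟩ := h₁
  obtain ⟨y₂, u₂, ht₂, h₂0, h₂T, h₂c⟩ := h₂
  refine ⟨_, _, ht₁.concat ht₂ (h₁T.trans h₂0.symm), ?_, ?_, ?_⟩
  · rw [concat_of_le_left (h₁T.trans h₂0.symm) ht₁.nonneg, h₁0]
  · rw [concat_of_le _ _ (by linarith [ht₂.nonneg]), add_sub_cancel_left, h₂T]
  · rw [ht₁.integral_concat ht₂ hΩ hw ⟨ht₂.nonneg, le_rfl⟩, h₁c, h₂c]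

lemma Steers.reverse {a b : Euc n} {c : ℝ} (h : Steers f Ω w T a b c) :
    Steers (fun a b => -f a b) Ω w T b a c := by
  obtain ⟨y, u, ht, h0, hT, hc⟩ := h
  refine ⟨_, _, ht.reverse, by simpa using hT, by simpa using h0, ?_⟩
  have := intervalIntegral.integral_comp_sub_left (a := 0) (b := T) (fun r => w (y r) (u r)) T
  simp only [sub_self, sub_zero] at this
  rw [this, hc]

lemma Steers.reverse_neg {a b : Euc n} {c : ℝ} (h : Steers (fun a b => -f a b) Ω w T a b c) :
    Steers f Ω w T b a c := by
  simpa only [neg_neg] using h.reverse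

lemma IsTrajectory.steers_left (h : IsTrajectory f Ω T y u) {t : ℝ} (ht : t ∈ Icc 0 T) :
    Steers f Ω w t (y 0) (y t) (∫ s in (0:ℝ)..t, w (y s) (u s)) :=
  ⟨y, u, h.mono ht, rfl, rfl, rfl⟩

lemma IsTrajectory.steers_right (h : IsTrajectory f Ω T y u) {t : ℝ} (ht : t ∈ Icc 0 T) :
    Steers f Ω w (T - t) (y t) (y T) (∫ s in t..T, w (y s) (u s)) := by
  refine ⟨_, _, h.shift ht, by simp, by simp, ?_⟩
  have := intervalIntegral.integral_comp_add_left (a := 0) (b := T - t)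
    (fun r => w (y r) (u r)) t
  simp only [add_zero, add_sub_cancel] at this
  exact this

lemma steers_const (hu : ubar ∈ Ω) (hf : f ybar ubar = 0) (hwbar : w ybar ubar = 0)
    (hT : 0 ≤ T) : Steers f Ω w T ybar ybar 0 :=
  ⟨_, _, isTrajectory_const hu hf hT, rfl, rfl, by simp [hwbar]⟩

lemma IsTrajectory.abs_integral_le (h : IsTrajectory f Ω T y u) {K C : ℝ}
    (hC : ∀ a ∈ closedBall ybar K, ∀ v ∈ Ω, |w a v| ≤ C)
    (hK : ∀ t ∈ Icc 0 T, ‖y t - ybar‖ ≤ K) {t : ℝ} (ht : t ∈ Icc 0 T) :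
    |∫ s in (0:ℝ)..t, w (y s) (u s)| ≤ C * t := by
  have := intervalIntegral.norm_integral_le_of_norm_le_const_ae (a := 0) (b := t) (C := C)
    (f := fun s => w (y s) (u s)) ?_
  · simpa [abs_of_nonneg ht.1] using this
  · filter_upwards [h.ae_mem] with s hs hs'
    rw [uIoc_of_le ht.1] at hs'
    have hsT : s ∈ Icc 0 T := ⟨hs'.1.le, hs'.2.trans ht.2⟩
    exact hC _ (by simpa [dist_eq_norm] using hK s hsT) _ (hs hsT)

/-- Points close to `ybar` are steered to `ybar` in small time, within distance `K` of `ybar`. -/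
def SmallTimeReach (f : Euc n → Euc p → Euc n) (Ω : Set (Euc p)) (ybar : Euc n) (K : ℝ) : Prop :=
  ∀ ε > (0 : ℝ), ∃ δ > (0 : ℝ), ∀ a, ‖a - ybar‖ < δ → ∃ τ y u, τ < ε ∧ IsTrajectory f Ω τ y u ∧
    y 0 = a ∧ y τ = ybar ∧ ∀ t ∈ Icc 0 τ, ‖y t - ybar‖ ≤ K

lemma smallTimeReach_of_minTime (hf : Continuous (Function.uncurry f)) (hΩ : IsCompact Ω)
    {r r2 K : ℝ} (hr : 0 < r) (hr2 : 0 < r2) (h0 : minTime f Ω ybar ybar = 0)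
    (hcont : ContinuousWithinAt (fun x' => minTime f Ω x' ybar) (ball ybar r) ybar)
    (h : ∀ x' ∈ closedBall ybar r2, ∃ y' u',
      IsAdmissible f Ω (minTime f Ω x' ybar) y' u' ∧ y' 0 = x' ∧
      y' (minTime f Ω x' ybar) = ybar ∧
      ∀ t ∈ Icc (0:ℝ) (minTime f Ω x' ybar), ‖y' t - ybar‖ + ‖u' t - ubar‖ ≤ K) :
    SmallTimeReach f Ω ybar K := by
  intro ε hε
  have hc := (hcont.continuousAt (ball_mem_nhds _ hr)).tendsto.eventually_lt_const (u := ε)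
    (by rwa [h0])
  obtain ⟨δ, hδ, hball⟩ := Metric.eventually_nhds_iff.1 hc
  refine ⟨min δ r2, lt_min hδ hr2, fun a ha => ?_⟩
  rw [← dist_eq_norm] at ha
  obtain ⟨y, u, hadm, hy0, hyT, hK⟩ := h a (ha.le.trans (min_le_right _ _))
  have hK' : ∀ t ∈ Icc (0:ℝ) (minTime f Ω a ybar), ‖y t - ybar‖ ≤ K := fun t ht =>
    (le_add_of_nonneg_right (norm_nonneg _)).trans (hK t ht)
  exact ⟨_, y, u, hball (ha.trans_le (min_le_left _ _)),
    hadm.isTrajectory_of_bounded (Real.sInf_nonneg fun t ht => ht.1) hf hΩ hK', hy0, hyT, hK'⟩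

lemma exists_abs_le_on_tube (hw : Continuous (Function.uncurry w)) (hΩ : IsCompact Ω)
    (ybar : Euc n) (K : ℝ) : ∃ C > 0, ∀ a ∈ closedBall ybar K, ∀ v ∈ Ω, |w a v| ≤ C := by
  obtain ⟨C, hC⟩ := ((isCompact_closedBall ybar K).prod hΩ).exists_bound_of_continuousOn
    hw.continuousOn
  exact ⟨max C 1, by positivity, fun a ha v hv => (hC (a, v) ⟨ha, hv⟩).trans (le_max_left _ _)⟩

lemma SmallTimeReach.exists_steers {K : ℝ} (h : SmallTimeReach f Ω ybar K)
    (hw : Continuous (Function.uncurry w)) (hΩ : IsCompact Ω) {ε : ℝ} (hε : 0 < ε) :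
    ∃ δ > (0 : ℝ), ∀ a, ‖a - ybar‖ < δ → ∃ τ c, Steers f Ω w τ a ybar c ∧ |c| < ε := by
  obtain ⟨C, hC0, hC⟩ := exists_abs_le_on_tube hw hΩ ybar K
  obtain ⟨δ, hδ, hreach⟩ := h (ε / C) (by positivity)
  refine ⟨δ, hδ, fun a ha => ?_⟩
  obtain ⟨τ, y, u, hτ, htraj, h0, h1, hK⟩ := hreach a ha
  refine ⟨τ, _, ⟨y, u, htraj, h0, h1, rfl⟩, ?_⟩
  refine (htraj.abs_integral_le hC hK ⟨htraj.nonneg, le_rfl⟩).trans_lt ?_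
  rwa [lt_div_iff₀ hC0, mul_comm] at hτ

variable {α : ℝ → ℝ}

lemma continuous_classK_norm (hα : IsClassK α) (ybar : Euc n) (ubar : Euc p) :
    Continuous (Function.uncurry fun (a : Euc n) (v : Euc p) => α ‖(a - ybar, v - ubar)‖) :=
  hα.1.comp_continuous (by fun_prop) fun _ => norm_nonneg _

lemma classK_le (hα : IsClassK α) {δ : ℝ} (hδ : 0 ≤ δ) {a : Euc n} {v : Euc p}
    (h : δ ≤ ‖a - ybar‖) : α δ ≤ α ‖(a - ybar, v - ubar)‖ :=
  hα.2.1.monotoneOn hδ (norm_nonneg _) (h.trans (norm_fst_le (a - ybar, v - ubar)))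

/-- A trajectory of bounded cost passes close to `ybar` if it is long enough. -/
lemma IsTrajectory.exists_norm_sub_lt (h : IsTrajectory f Ω T y u) (hΩ : IsCompact Ω)
    (hα : IsClassK α) {δ B : ℝ} (hδ : 0 ≤ δ)
    (hB : ∫ t in (0:ℝ)..T, α ‖(y t - ybar, u t - ubar)‖ ≤ B) (hT : B < T * α δ) :
    ∃ t ∈ Icc 0 T, ‖y t - ybar‖ < δ := by
  by_contra! hcon
  have h1 : ∫ _ in (0:ℝ)..T, α δ ≤ ∫ t in (0:ℝ)..T, α ‖(y t - ybar, u t - ubar)‖ :=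
    intervalIntegral.integral_mono_on h.nonneg intervalIntegrable_const
      (h.intervalIntegrable hΩ (continuous_classK_norm hα ybar ubar))
      fun t ht => classK_le hα hδ (hcon t ht)
  simp only [intervalIntegral.integral_const, sub_zero, smul_eq_mul] at h1
  linarith

lemma IsTrajectory.integral_classK_pos (h : IsTrajectory f Ω T y u) (hΩ : IsCompact Ω)
    (hα : IsClassK α) (h0 : y 0 = ybar) {s : ℝ} (hs : s ∈ Icc 0 T) (hys : y s ≠ ybar) :
    0 < ∫ t in (0:ℝ)..T, α ‖(y t - ybar, u t - ubar)‖ := by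
  have hT : 0 < T := by
    refine h.nonneg.lt_of_ne ?_
    rintro rfl
    exact hys (by rw [le_antisymm hs.2 hs.1, h0])
  have hyα : ContinuousOn (fun t => α ‖y t - ybar‖) (Icc 0 T) :=
    hα.1.comp (h.continuousOn.sub continuousOn_const).norm fun _ _ => norm_nonneg _
  refine lt_of_lt_of_le (intervalIntegral.integral_pos hT hyα
    (fun t _ => hα.2.2.2 _ (norm_nonneg _)) ⟨s, hs, ?_⟩)
    (intervalIntegral.integral_mono_on h.nonneg
      (hyα.intervalIntegrable_of_Icc h.nonneg)
      (h.intervalIntegrable hΩ (continuous_classK_norm hα ybar ubar))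
      fun t _ => classK_le hα (norm_nonneg _) le_rfl)
  rw [← hα.2.2.1]
  exact hα.2.1 self_mem_Ici (norm_nonneg _) (norm_pos_iff.2 (sub_ne_zero.2 hys))

/-- Small-time reachability in both time directions produces loops at `ybar`
of arbitrarily small positive cost. -/
lemma exists_loop {g : Euc n → Euc p → Euc n} (hgf : f = fun a b => -g a b) [Nontrivial (Euc n)]
    (hw : Continuous (Function.uncurry w)) (hΩ : IsCompact Ω)
    (hv : ubar ∈ Ω) (hfa : f ybar ubar = 0) (hwa : w ybar ubar = 0) (hα : IsClassK α)
    (hdis : ∀ T y u, IsTrajectory f Ω T y u → y 0 = y T →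
      ∫ t in (0:ℝ)..T, α ‖(y t - ybar, u t - ubar)‖ ≤ ∫ t in (0:ℝ)..T, w (y t) (u t))
    {K : ℝ} (hf : SmallTimeReach f Ω ybar K) (hg : SmallTimeReach g Ω ybar K)
    {ε : ℝ} (hε : 0 < ε) :
    ∃ y u, IsTrajectory f Ω 1 y u ∧ y 0 = ybar ∧ y 1 = ybar ∧
      0 < (∫ t in (0:ℝ)..1, w (y t) (u t)) ∧
      ∀ s ∈ Icc (0 : ℝ) 1, |∫ t in (0:ℝ)..s, w (y t) (u t)| ≤ ε := by
  obtain ⟨C, hC0, hC⟩ := exists_abs_le_on_tube hw hΩ ybar K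
  have hη : 0 < min (1 / 2) (ε / (2 * C)) := by positivity
  obtain ⟨δ₁, hδ₁, hreach₁⟩ := hf _ hη
  obtain ⟨δ₂, hδ₂, hreach₂⟩ := hg _ hη
  have hδ : 0 < min δ₁ δ₂ / 2 := by positivity
  obtain ⟨d, hd⟩ := exists_norm_eq (Euc n) hδ.le
  have hnorm : ‖ybar + d - ybar‖ < min δ₁ δ₂ := by
    rw [add_sub_cancel_left, hd]
    linarith
  have hne : ybar + d ≠ ybar := by
    intro h
    rw [add_eq_left.1 h, norm_zero] at hd
    linarith
  obtain ⟨τ₁, y₁, u₁, hτ₁, ht₁, h₁0, h₁T, h₁K⟩ := hreach₁ _ (hnorm.trans_le (min_le_left _ _))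
  obtain ⟨τ₂, y₂, u₂, hτ₂, ht₂, h₂0, h₂T, h₂K⟩ := hreach₂ _ (hnorm.trans_le (min_le_right _ _))
  have ht₃ := ht₂.reverse
  rw [← hgf] at ht₃
  set y₃ : ℝ → Euc n := fun t => y₂ (τ₂ - t)
  set u₃ : ℝ → Euc p := fun t => u₂ (τ₂ - t)
  have h₃0 : y₃ 0 = ybar := by simp [y₃, h₂T]
  have h₃T : y₃ τ₂ = ybar + d := by simp [y₃, h₂0]
  have h₃₁ : y₃ τ₂ = y₁ 0 := h₃T.trans h₁0.symm
  have ht := ht₃.concat ht₁ h₃₁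
  set y := concat τ₂ y₃ y₁
  set u := concat τ₂ u₃ u₁
  set τ := τ₂ + τ₁
  have hτε : C * τ ≤ ε := by
    have h1 := hτ₁.trans_le (min_le_right _ _)
    have h2 := hτ₂.trans_le (min_le_right _ _)
    have h3 : τ ≤ ε / C := by
      have : ε / C = ε / (2 * C) + ε / (2 * C) := by field_simp; ring
      linarith
    rwa [le_div_iff₀ hC0, mul_comm] at h3
  have hτ1 : τ ≤ 1 := by
    linarith [hτ₁.trans_le (min_le_left _ _), hτ₂.trans_le (min_le_left _ _)]
  have hK : ∀ t ∈ Icc 0 τ, ‖y t - ybar‖ ≤ K := by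
    intro t ht'
    rcases lt_or_ge t τ₂ with hlt | hle
    · rw [show y t = _ from concat_of_lt _ _ hlt]
      exact h₂K _ ⟨by linarith, by linarith [ht'.1]⟩
    · rw [show y t = _ from concat_of_le _ _ hle]
      exact h₁K _ ⟨by linarith, by linarith [ht'.2]⟩
  have hy0 : y 0 = ybar := (concat_of_le_left h₃₁ ht₃.nonneg).trans h₃0
  have hyτ : y τ = ybar := by
    rw [show y τ = _ from concat_of_le _ _ (by linarith [ht₁.nonneg]), add_sub_cancel_left, h₁T]
  have hpos : 0 < ∫ t in (0:ℝ)..τ, w (y t) (u t) := by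
    refine (ht.integral_classK_pos hΩ hα hy0 ⟨ht₃.nonneg, by linarith [ht₁.nonneg]⟩ ?_).trans_le
      (hdis τ y u ht (hy0.trans hyτ.symm))
    rwa [show y τ₂ = _ from concat_of_le_left h₃₁ le_rfl, h₃T]
  have hbound : ∀ t ∈ Icc 0 τ, |∫ s in (0:ℝ)..t, w (y s) (u s)| ≤ ε := fun t ht' =>
    (ht.abs_integral_le hC hK ht').trans
      ((mul_le_mul_of_nonneg_left ht'.2 hC0.le).trans hτε)
  have hwait : IsTrajectory f Ω (1 - τ) (fun _ => ybar) (fun _ => ubar) :=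
    isTrajectory_const hv hfa (sub_nonneg.2 hτ1)
  have hafter : ∀ s ∈ Icc τ 1, ∫ t in (0:ℝ)..s, w (concat τ y (fun _ => ybar) t)
      (concat τ u (fun _ => ubar) t) = ∫ t in (0:ℝ)..τ, w (y t) (u t) := by
    intro s hs
    have := ht.integral_concat hwait hΩ hw (t := s - τ) ⟨sub_nonneg.2 hs.1, by linarith [hs.2]⟩
    rw [add_sub_cancel] at this
    rw [this]
    simp [hwa]
  have hfull := ht.concat hwait hyτ
  rw [add_sub_cancel] at hfull
  refine ⟨_, _, hfull, ?_, concat_of_le _ _ hτ1, ?_, fun s hs => ?_⟩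
  · rw [concat_of_le_left hyτ ht.nonneg, hy0]
  · rwa [hafter 1 ⟨hτ1, le_rfl⟩]
  · rcases le_total s τ with hle | hle
    · rw [integral_concat_left w ⟨hs.1, hle⟩]
      exact hbound s ⟨hs.1, hle⟩
    · rw [hafter s ⟨hle, hs.2⟩]
      exact hbound τ ⟨ht.nonneg, le_rfl⟩

lemma IsTrajectory.concat_forall {T₁ : ℝ} (h₁ : IsTrajectory f Ω T₁ y₁ u₁)
    (h₂ : ∀ T, 0 ≤ T → IsTrajectory f Ω T y₂ u₂) (h : y₁ T₁ = y₂ 0) :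
    ∀ T, 0 ≤ T →
      IsTrajectory f Ω T (_root_.concat T₁ y₁ y₂) (_root_.concat T₁ u₁ u₂) := fun T hT =>
  (h₁.concat (h₂ T hT) h).mono ⟨hT, le_add_of_nonneg_left h₁.nonneg⟩

lemma IsTrajectory.tendsto_integral_concat {T₁ κ : ℝ} (h₁ : IsTrajectory f Ω T₁ y₁ u₁)
    (h₂ : ∀ T, 0 ≤ T → IsTrajectory f Ω T y₂ u₂) (hΩ : IsCompact Ω)
    (hw : Continuous (Function.uncurry w))
    (hκ : Tendsto (fun T => ∫ t in (0:ℝ)..T, w (y₂ t) (u₂ t)) atTop (𝓝 κ)) :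
    Tendsto (fun T => ∫ t in (0:ℝ)..T, w (_root_.concat T₁ y₁ y₂ t) (_root_.concat T₁ u₁ u₂ t)) atTop
      (𝓝 ((∫ t in (0:ℝ)..T₁, w (y₁ t) (u₁ t)) + κ)) := by
  have hshift : Tendsto (fun T : ℝ => T - T₁) atTop atTop := tendsto_atTop_add_const_right _ _ tendsto_id
  refine ((hκ.comp hshift).const_add _).congr' ?_
  filter_upwards [eventually_ge_atTop T₁] with T hT
  have := h₁.integral_concat (h₂ (T - T₁) (sub_nonneg.2 hT)) hΩ hw ⟨sub_nonneg.2 hT, le_rfl⟩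
  rw [add_sub_cancel] at this
  exact this.symm

/-- The infinite-horizon value is at most the cost of any trajectory reaching `ybar`. If the set of
costs is not bounded below, its infimum is zero by convention, and inserting loops into a trajectory
of negative cost contradicts the uniqueness of the optimal solution. -/
lemma vInf_le_of_steers (hw : Continuous (Function.uncurry w)) (hΩ : IsCompact Ω)
    (hv : ubar ∈ Ω) (hfa : f ybar ubar = 0) (hwa : w ybar ubar = 0) {a : Euc n}
    (hcase : BddBelow {c | ∃ y u, IsAdmissibleInf f Ω y u ∧ y 0 = a ∧
        Tendsto (fun T => ∫ t in (0:ℝ)..T, w (y t) (u t)) atTop (𝓝 c)} ∨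
      ∀ ε > (0 : ℝ), ∃ y u, IsTrajectory f Ω 1 y u ∧ y 0 = ybar ∧ y 1 = ybar ∧
        0 < (∫ t in (0:ℝ)..1, w (y t) (u t)) ∧
        ∀ s ∈ Icc (0 : ℝ) 1, |∫ t in (0:ℝ)..s, w (y t) (u t)| ≤ ε)
    {yo : ℝ → Euc n} {uo : ℝ → Euc p}
    (hopt : Tendsto (fun T => ∫ t in (0:ℝ)..T, w (yo t) (uo t)) atTop (𝓝 (vInf f Ω w a)))
    (huniq : ∀ y' u', IsAdmissibleInf f Ω y' u' → y' 0 = a →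
      Tendsto (fun T => ∫ t in (0:ℝ)..T, w (y' t) (u' t)) atTop (𝓝 (vInf f Ω w a)) →
      (∀ t, 0 ≤ t → y' t = yo t) ∧ (∀ᵐ t ∂(volume.restrict (Ici (0:ℝ))), u' t = uo t))
    {c : ℝ} (h : Steers f Ω w T a ybar c) : vInf f Ω w a ≤ c := by
  obtain ⟨y, u, ht, h0, h1, hc⟩ := h
  have hwait : ∀ S, 0 ≤ S → IsTrajectory f Ω S (fun _ => ybar) (fun _ => ubar) := fun S hS =>
    isTrajectory_const hv hfa hS
  by_cases hb : BddBelow {c | ∃ y u, IsAdmissibleInf f Ω y u ∧ y 0 = a ∧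
        Tendsto (fun T => ∫ t in (0:ℝ)..T, w (y t) (u t)) atTop (𝓝 c)}
  · refine csInf_le hb ⟨_, _, isAdmissibleInf_iff_forall.2 fun S hS =>
      (ht.concat_forall hwait h1 S hS).admissible, ?_, ?_⟩
    · rw [concat_of_le_left (b := fun _ => ybar) h1 ht.nonneg, h0]
    · have := ht.tendsto_integral_concat hwait hΩ hw (κ := 0) (by simp [hwa])
      rwa [add_zero, hc] at this
  · have hv0 : vInf f Ω w a = 0 := Real.sInf_of_not_bddBelow hb
    by_contra! hlt
    rw [hv0] at hlt
    obtain ⟨yl, ul, htl, hl0, hlκ⟩ :=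
      exists_cost_eq_of_loops hw hΩ hv hfa hwa (hcase.resolve_left hb) (neg_pos.2 hlt)
    have hpartial : ∀ d, 0 ≤ d → ∫ t in (0:ℝ)..T + d, w (yo t) (uo t) = c := by
      intro d hd
      have hjoin := (hwait d hd).concat_forall htl hl0.symm
      have hjoin0 : y T = concat d (fun _ => ybar) yl 0 := by
        rw [concat_of_le_left hl0.symm hd, h1]
      have hinf := ht.concat_forall hjoin hjoin0
      have hcost := ht.tendsto_integral_concat hjoin hΩ hw
        ((hwait d hd).tendsto_integral_concat htl hΩ hw hlκ)
      have hcost0 : (∫ t in (0:ℝ)..T, w (y t) (u t)) +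
          ((∫ _ in (0:ℝ)..d, w ybar ubar) + -c) = vInf f Ω w a := by
        rw [hc, hv0, hwa]; simp
      rw [hcost0] at hcost
      obtain ⟨hyeq, hueq⟩ := huniq _ _ (isAdmissibleInf_iff_forall.2 fun S hS =>
        (hinf S hS).admissible) (by rw [concat_of_le_left hjoin0 ht.nonneg, h0]) hcost
      rw [ae_restrict_iff' measurableSet_Ici] at hueq
      have hTd : 0 ≤ T + d := add_nonneg ht.nonneg hd
      have h2 := ht.integral_concat (hjoin d hd) hΩ hw ⟨hd, le_rfl⟩
      rw [integral_concat_left w ⟨hd, le_rfl⟩, hc, hwa, intervalIntegral.integral_zero,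
        add_zero] at h2
      rw [← h2]
      refine intervalIntegral.integral_congr_ae ?_
      filter_upwards [hueq] with t hut htm
      rw [uIoc_of_le hTd] at htm
      rw [hyeq t htm.1.le, hut htm.1.le]
    have hlim := hopt.comp (tendsto_atTop_add_const_left atTop T tendsto_id)
    have : vInf f Ω w a = c := by
      refine tendsto_nhds_unique hlim (tendsto_const_nhds.congr' ?_)
      filter_upwards [eventually_ge_atTop 0] with d hd
      exact (hpartial d hd).symm
    rw [hv0] at this
    exact hlt.ne this.symm

/-- An infinite-horizon trajectory of bounded partial costs can be redirected to `ybar` at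
an arbitrarily small extra cost. -/
lemma exists_steers_of_tendsto (hw : Continuous (Function.uncurry w)) (hΩ : IsCompact Ω)
    (hα : IsClassK α) {K D B v : ℝ} (hreach : SmallTimeReach f Ω ybar K)
    (hdis : ∀ T y u, IsTrajectory f Ω T y u →
      ∫ t in (0:ℝ)..T, α ‖(y t - ybar, u t - ubar)‖ ≤ (∫ t in (0:ℝ)..T, w (y t) (u t)) + D)
    (hy : ∀ T, 0 ≤ T → IsTrajectory f Ω T y u)
    (hB : ∀ T, 0 ≤ T → |∫ t in (0:ℝ)..T, w (y t) (u t)| ≤ B)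
    (hv : Tendsto (fun T => ∫ t in (0:ℝ)..T, w (y t) (u t)) atTop (𝓝 v)) {ε : ℝ} (hε : 0 < ε) :
    ∃ τ c, Steers f Ω w τ (y 0) ybar c ∧ c < v + ε := by
  obtain ⟨δ, hδ, hsteer⟩ := hreach.exists_steers hw hΩ (half_pos hε)
  obtain ⟨L, hL⟩ := eventually_atTop.1
    ((hv.eventually_lt_const (lt_add_of_pos_right v (half_pos hε))).and (eventually_ge_atTop 0))
  have hL0 : 0 ≤ L := (hL L le_rfl).2
  have hαδ : 0 < α δ := by
    rw [← hα.2.2.1]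
    exact hα.2.1 self_mem_Ici hδ.le hδ
  obtain ⟨k, hk⟩ := exists_nat_gt ((2 * B + D) / α δ)
  rw [div_lt_iff₀ hαδ] at hk
  have hLk : L ∈ Icc 0 (L + k) := ⟨hL0, le_add_of_nonneg_right k.cast_nonneg⟩
  have hLk0 : 0 ≤ L + k := add_nonneg hL0 k.cast_nonneg
  have htail := (hy (L + k) hLk0).shift hLk
  rw [add_sub_cancel_left] at htail
  have hcost : ∫ t in (0:ℝ)..k, w (y (L + t)) (u (L + t)) ≤ 2 * B := by
    have h1 := intervalIntegral.integral_comp_add_left (a := 0) (b := (k : ℝ))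
      (fun r => w (y r) (u r)) L
    simp only [add_zero] at h1
    have h2 := intervalIntegral.integral_add_adjacent_intervals
      ((hy L hL0).intervalIntegrable hΩ hw)
      (((hy L hL0).intervalIntegrable hΩ hw).symm.trans ((hy _ hLk0).intervalIntegrable hΩ hw))
    rw [h1]
    linarith [abs_le.1 (hB L hL0), abs_le.1 (hB _ hLk0)]
  obtain ⟨t, ht, hnear⟩ := htail.exists_norm_sub_lt hΩ hα hδ.le
    ((hdis _ _ _ htail).trans (add_le_add_left hcost D)) hk
  obtain ⟨τ, c, hc, hcε⟩ := hsteer _ hnear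
  have hLt : 0 ≤ L + t := add_nonneg hL0 ht.1
  have hfirst := (hy (L + t) hLt).steers_left (w := w) ⟨hLt, le_rfl⟩
  refine ⟨_, _, hfirst.trans hw hΩ hc, ?_⟩
  linarith [(hL (L + t) (le_add_of_nonneg_right ht.1)).1, (abs_lt.1 hcε).2]

end Turnpike

section Value

variable {n p : ℕ} {f : Euc n → Euc p → Euc n} {f0 w : Euc n → Euc p → ℝ} {Ω : Set (Euc p)}

lemma bddBelow_infinite_costs {D : ℝ} {a : Euc n}
    (h : ∀ T > (0 : ℝ), ∀ y u, IsAdmissible f Ω T y u → -D ≤ ∫ t in (0:ℝ)..T, w (y t) (u t)) :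
    BddBelow {c | ∃ y u, IsAdmissibleInf f Ω y u ∧ y 0 = a ∧
      Tendsto (fun T => ∫ t in (0:ℝ)..T, w (y t) (u t)) atTop (𝓝 c)} := by
  refine ⟨-D, ?_⟩
  rintro c ⟨y, u, hadm, -, hc⟩
  refine ge_of_tendsto hc ?_
  filter_upwards [eventually_gt_atTop 0] with T hT
  exact h T hT y u (isAdmissibleInf_iff_forall.1 hadm T hT.le)

lemma integral_sub_const {y : ℝ → Euc n} {u : ℝ → Euc p} {T : ℝ} (v : ℝ)
    (h : IntervalIntegrable (fun t => f0 (y t) (u t)) volume 0 T) :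
    ∫ t in (0:ℝ)..T, (f0 (y t) (u t) - v) = (∫ t in (0:ℝ)..T, f0 (y t) (u t)) - T * v := by
  rw [intervalIntegral.integral_sub h intervalIntegrable_const]
  simp

lemma valueFn_le_of_steers {v D T : ℝ} (hf0 : Continuous (Function.uncurry f0))
    (hΩ : IsCompact Ω)
    (h : ∀ y u, IsAdmissible f Ω T y u → -D ≤ ∫ t in (0:ℝ)..T, (f0 (y t) (u t) - v))
    {x z : Euc n} {c : ℝ} (hc : Steers f Ω (fun a b => f0 a b - v) T x z c) :
    valueFn f f0 Ω T x z ≤ c + T * v := by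
  obtain ⟨y, u, ht, h0, h1, hyc⟩ := hc
  refine csInf_le ⟨min 0 (T * v - D), ?_⟩ ⟨y, u, ht.admissible, h0, h1, ?_⟩
  · rintro c ⟨y, u, hadm, -, -, rfl⟩
    by_cases hi : IntervalIntegrable (fun t => f0 (y t) (u t)) volume 0 T
    · have := h y u hadm
      rw [integral_sub_const v hi] at this
      exact (min_le_right _ _).trans (by linarith)
    · rw [intervalIntegral.integral_undef hi]
      exact min_le_left _ _
  · rw [integral_sub_const v (ht.intervalIntegrable hΩ hf0)] at hyc
    linarith

end Value

/-- Theorem 5.1: two-term large-time expansion of the value function: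
`v(T,x,z) = T·v̄ + v_f(x) + v_b(z) + o(1)` as `T → +∞`. -/
theorem value_two_term_expansion
    {n pp : ℕ} (c : ℝ)
    (f : Euc n → Euc pp → Euc n) (f0 : Euc n → Euc pp → ℝ)
    (Ω : Set (Euc pp))
    -- (A1) regularity of the data
    (hf : ContDiff ℝ 1 (Function.uncurry f))
    (hf0 : ContDiff ℝ 1 (Function.uncurry f0))
    (hΩcpt : IsCompact Ω) (hΩball : Ω ⊆ closedBall 0 c)
    -- static problem and its unique minimizer
    (ybar : Euc n) (ubar : Euc pp) (vbar : ℝ)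
    (hfbar : f ybar ubar = 0) (hvbar : f0 ybar ubar = vbar)
    (hstatmin : ∀ y u, f y u = 0 → vbar ≤ f0 y u)
    (hstatuniq : ∀ y u, f y u = 0 → f0 y u = vbar → y = ybar ∧ u = ubar)
    -- shifted cost
    (w : Euc n → Euc pp → ℝ) (hwdef : w = fun y u => f0 y u - f0 ybar ubar)
    (x z : Euc n)
    -- (A2): existence and uniqueness of optimal solutions
    (T0 : ℝ) (hT0 : 0 < T0)
    (yT : ℝ → ℝ → Euc n) (uT : ℝ → ℝ → Euc pp)
    (yf : ℝ → Euc n) (uf : ℝ → Euc pp) (yb : ℝ → Euc n) (ub : ℝ → Euc pp)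
    (hoptT : ∀ T, T0 ≤ T → IsAdmissible f Ω T (yT T) (uT T) ∧ yT T 0 = x ∧ yT T T = z ∧
      (∫ t in (0:ℝ)..T, f0 (yT T t) (uT T t)) = valueFn f f0 Ω T x z)
    (huniqT : ∀ T, T0 ≤ T → ∀ y' u', IsAdmissible f Ω T y' u' → y' 0 = x → y' T = z →
      (∫ t in (0:ℝ)..T, f0 (y' t) (u' t)) = valueFn f f0 Ω T x z →
      (∀ t ∈ Icc (0:ℝ) T, y' t = yT T t) ∧
      (∀ᵐ t ∂(volume.restrict (Icc (0:ℝ) T)), u' t = uT T t))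
    (hoptf : IsAdmissibleInf f Ω yf uf ∧ yf 0 = x ∧
      Tendsto (fun T => ∫ t in (0:ℝ)..T, w (yf t) (uf t)) atTop (𝓝 (vInf f Ω w x)))
    (huniqf : ∀ y' u', IsAdmissibleInf f Ω y' u' → y' 0 = x →
      Tendsto (fun T => ∫ t in (0:ℝ)..T, w (y' t) (u' t)) atTop (𝓝 (vInf f Ω w x)) →
      (∀ t, 0 ≤ t → y' t = yf t) ∧ (∀ᵐ t ∂(volume.restrict (Ici (0:ℝ))), u' t = uf t))
    (hoptb : IsAdmissibleInf (fun a b => -f a b) Ω yb ub ∧ yb 0 = z ∧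
      Tendsto (fun T => ∫ t in (0:ℝ)..T, w (yb t) (ub t)) atTop
        (𝓝 (vInf (fun a b => -f a b) Ω w z)))
    (huniqb : ∀ y' u', IsAdmissibleInf (fun a b => -f a b) Ω y' u' → y' 0 = z →
      Tendsto (fun T => ∫ t in (0:ℝ)..T, w (y' t) (u' t)) atTop
        (𝓝 (vInf (fun a b => -f a b) Ω w z)) →
      (∀ t, 0 ≤ t → y' t = yb t) ∧ (∀ᵐ t ∂(volume.restrict (Ici (0:ℝ))), u' t = ub t))
    -- (A3): uniform boundedness of the optimal trajectories
    (b : ℝ)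
    (hbndT : ∀ T, T0 ≤ T → ∀ t ∈ Icc (0:ℝ) T, ‖yT T t‖ ≤ b)
    (hbndf : ∀ t, 0 ≤ t → ‖yf t‖ ≤ b)
    (hbndb : ∀ t, 0 ≤ t → ‖yb t‖ ≤ b)
    -- (A4): uniform boundedness of the optimal (shifted) costs
    (M : ℝ)
    (hcstT : ∀ T, T0 ≤ T → |∫ t in (0:ℝ)..T, w (yT T t) (uT T t)| ≤ M)
    (hcstf : ∀ T, 0 ≤ T → |∫ t in (0:ℝ)..T, w (yf t) (uf t)| ≤ M)
    (hcstb : ∀ T, 0 ≤ T → |∫ t in (0:ℝ)..T, w (yb t) (ub t)| ≤ M)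
    -- (A5): the static control is interior
    (hubar : ubar ∈ interior Ω)
    -- (A6): strict dissipativity
    (S : Euc n → ℝ) (α : ℝ → ℝ)
    (hdis : StrictlyDissipative f Ω w ybar ubar S α)
    -- (A7): minimum time functions are finite (and attained) near ȳ, vanish and are continuous at ȳ
    (r : ℝ) (hr : 0 < r)
    (hreachf : ∀ x' ∈ ball ybar r, minTime f Ω x' ybar ∈ reachTimes f Ω x' ybar)
    (hreachb : ∀ x' ∈ ball ybar r,
      minTime (fun a b => -f a b) Ω x' ybar ∈ reachTimes (fun a b => -f a b) Ω x' ybar)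
    (hτf0 : minTime f Ω ybar ybar = 0)
    (hτb0 : minTime (fun a b => -f a b) Ω ybar ybar = 0)
    (hτfcont : ContinuousWithinAt (fun x' => minTime f Ω x' ybar) (ball ybar r) ybar)
    (hτbcont : ContinuousWithinAt (fun x' => minTime (fun a b => -f a b) Ω x' ybar)
      (ball ybar r) ybar)
    -- (A8): local boundedness of the minimum time trajectories and controls near the turnpike
    (r2 Kr : ℝ) (hr2 : 0 < r2) (hKr : 0 < Kr)
    (hA8f : ∀ x' ∈ closedBall ybar r2, ∃ y' u',
      IsAdmissible f Ω (minTime f Ω x' ybar) y' u' ∧ y' 0 = x' ∧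
      y' (minTime f Ω x' ybar) = ybar ∧
      ∀ t ∈ Icc (0:ℝ) (minTime f Ω x' ybar), ‖y' t - ybar‖ + ‖u' t - ubar‖ ≤ Kr)
    (hA8b : ∀ x' ∈ closedBall ybar r2, ∃ y' u',
      IsAdmissible (fun a b => -f a b) Ω (minTime (fun a b => -f a b) Ω x' ybar) y' u' ∧
      y' 0 = x' ∧ y' (minTime (fun a b => -f a b) Ω x' ybar) = ybar ∧
      ∀ t ∈ Icc (0:ℝ) (minTime (fun a b => -f a b) Ω x' ybar),
        ‖y' t - ybar‖ + ‖u' t - ubar‖ ≤ Kr)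
    :
    Tendsto (fun T => valueFn f f0 Ω T x z - T * vbar) atTop
      (𝓝 (vInf f Ω w x + vInf (fun a b => -f a b) Ω w z)) := by
  have hfc := hf.continuous
  have hgc : Continuous (Function.uncurry fun a b => -f a b) := hfc.neg
  have hwv : w = fun a b => f0 a b - vbar := by rw [hwdef, hvbar]
  have hw : Continuous (Function.uncurry w) := by
    rw [hwv]
    exact hf0.continuous.sub continuous_const
  have hwbar : w ybar ubar = 0 := by rw [hwdef]; exact sub_self _
  have hubarΩ : ubar ∈ Ω := interior_subset hubar
  have hgbar : (fun a b => -f a b) ybar ubar = 0 := by simp [hfbar]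
  obtain ⟨⟨Ms, hMs⟩, hα, hdiss⟩ := hdis
  -- the dissipation inequality along trajectories, in both time directions
  have hdf : ∀ T y u, IsTrajectory f Ω T y u →
      S (y T) + ∫ t in (0:ℝ)..T, α ‖(y t - ybar, u t - ubar)‖ ≤
        S (y 0) + ∫ t in (0:ℝ)..T, w (y t) (u t) := by
    intro T y u h
    rcases h.nonneg.eq_or_lt with rfl | hT
    · simp
    · exact hdiss T hT y u h.admissible
  have hdb : ∀ T y u, IsTrajectory (fun a b => -f a b) Ω T y u →
      S (y 0) + ∫ t in (0:ℝ)..T, α ‖(y t - ybar, u t - ubar)‖ ≤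
        S (y T) + ∫ t in (0:ℝ)..T, w (y t) (u t) := by
    intro T y u h
    have h1 := h.reverse
    simp only [neg_neg] at h1
    have h2 := hdf T _ _ h1
    rw [intervalIntegral.integral_comp_sub_left (fun t => α ‖(y t - ybar, u t - ubar)‖) T,
      intervalIntegral.integral_comp_sub_left (fun t => w (y t) (u t)) T] at h2
    simpa using h2
  have hDf : ∀ T y u, IsTrajectory f Ω T y u →
      ∫ t in (0:ℝ)..T, α ‖(y t - ybar, u t - ubar)‖ ≤
        (∫ t in (0:ℝ)..T, w (y t) (u t)) + 2 * Ms := fun T y u h => by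
    linarith [hdf T y u h, abs_le.1 (hMs (y 0)), abs_le.1 (hMs (y T))]
  have hDb : ∀ T y u, IsTrajectory (fun a b => -f a b) Ω T y u →
      ∫ t in (0:ℝ)..T, α ‖(y t - ybar, u t - ubar)‖ ≤
        (∫ t in (0:ℝ)..T, w (y t) (u t)) + 2 * Ms := fun T y u h => by
    linarith [hdb T y u h, abs_le.1 (hMs (y 0)), abs_le.1 (hMs (y T))]
  have hlow : ∀ T > (0:ℝ), ∀ y u, IsAdmissible f Ω T y u →
      -(2 * Ms) ≤ ∫ t in (0:ℝ)..T, w (y t) (u t) := by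
    intro T hT y u h
    have h1 : 0 ≤ ∫ t in (0:ℝ)..T, α ‖(y t - ybar, u t - ubar)‖ :=
      intervalIntegral.integral_nonneg hT.le fun t _ => hα.2.2.2 _ (norm_nonneg _)
    linarith [hdiss T hT y u h, abs_le.1 (hMs (y 0)), abs_le.1 (hMs (y T))]
  have hreach_f : SmallTimeReach f Ω ybar Kr :=
    smallTimeReach_of_minTime hfc hΩcpt hr hr2 hτf0 hτfcont hA8f
  have hreach_b : SmallTimeReach (fun a b => -f a b) Ω ybar Kr :=
    smallTimeReach_of_minTime hgc hΩcpt hr hr2 hτb0 hτbcont hA8b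
  -- infinite-horizon values are below the cost of every trajectory ending at `ybar`
  have hvf : ∀ {T c}, Steers f Ω w T x ybar c → vInf f Ω w x ≤ c := fun h =>
    vInf_le_of_steers hw hΩcpt hubarΩ hfbar hwbar (.inl (bddBelow_infinite_costs hlow)) hoptf.2.2
      huniqf h
  have hvb : ∀ {T c}, Steers (fun a b => -f a b) Ω w T z ybar c →
      vInf (fun a b => -f a b) Ω w z ≤ c := by
    intro T c h
    refine vInf_le_of_steers hw hΩcpt hubarΩ hgbar hwbar ?_ hoptb.2.2 huniqb h
    rcases subsingleton_or_nontrivial (Euc n) with hn | hn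
    · have hneg : (fun a b => -f a b) = f := by
        funext a b
        exact Subsingleton.elim _ _
      rw [hneg]
      exact .inl (bddBelow_infinite_costs hlow)
    · refine .inr fun ε hε => exists_loop rfl hw hΩcpt hubarΩ hgbar hwbar hα
        (fun T y u ht hclosed => ?_) hreach_b hreach_f hε
      have := hdb T y u ht
      rw [hclosed] at this
      linarith
  have htraj_f : ∀ T, 0 ≤ T → IsTrajectory f Ω T yf uf := fun T hT =>
    (isAdmissibleInf_iff_forall.1 hoptf.1 T hT).isTrajectory_of_bounded (a := 0) hT hfc hΩcpt
      fun t ht => by simpa using hbndf t ht.1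
  have htraj_b : ∀ T, 0 ≤ T → IsTrajectory (fun a b => -f a b) Ω T yb ub := fun T hT =>
    (isAdmissibleInf_iff_forall.1 hoptb.1 T hT).isTrajectory_of_bounded (a := 0) hT hgc hΩcpt
      fun t ht => by simpa using hbndb t ht.1
  rw [tendsto_order]
  constructor
  · intro l hl
    obtain ⟨ε, hε, hlε⟩ : ∃ ε > 0, l < vInf f Ω w x + vInf (fun a b => -f a b) Ω w z - 2 * ε :=
      ⟨(vInf f Ω w x + vInf (fun a b => -f a b) Ω w z - l) / 4, by linarith, by linarith⟩
    obtain ⟨δ₁, hδ₁, hsteer₁⟩ := hreach_f.exists_steers hw hΩcpt hε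
    obtain ⟨δ₂, hδ₂, hsteer₂⟩ := hreach_b.exists_steers hw hΩcpt hε
    have hδ : 0 < min δ₁ δ₂ := lt_min hδ₁ hδ₂
    have hαδ : 0 < α (min δ₁ δ₂) := by
      rw [← hα.2.2.1]
      exact hα.2.1 self_mem_Ici hδ.le hδ
    filter_upwards [eventually_ge_atTop T0, eventually_gt_atTop ((M + 2 * Ms) / α (min δ₁ δ₂))]
      with T hT hTlarge
    rw [div_lt_iff₀ hαδ] at hTlarge
    obtain ⟨hadm, hx, hz, hval⟩ := hoptT T hT
    have ht : IsTrajectory f Ω T (yT T) (uT T) :=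
      hadm.isTrajectory_of_bounded (a := 0) (hT0.le.trans hT) hfc hΩcpt
        fun t ht => by simpa using hbndT T hT t ht
    obtain ⟨s, hs, hnear⟩ := ht.exists_norm_sub_lt hΩcpt hα hδ.le ((hDf _ _ _ ht).trans
      (add_le_add_left ((le_abs_self _).trans (hcstT T hT)) _)) hTlarge
    obtain ⟨τ₁, c₁, hst₁, hc₁⟩ := hsteer₁ _ (hnear.trans_le (min_le_left _ _))
    obtain ⟨τ₂, c₂, hst₂, hc₂⟩ := hsteer₂ _ (hnear.trans_le (min_le_right _ _))
    have hleft := ht.steers_left (w := w) hs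
    have hright := (ht.steers_right (w := w) hs).reverse
    rw [hx] at hleft
    rw [hz] at hright
    have h1 := hvf (hleft.trans hw hΩcpt hst₁)
    have h2 := hvb (hright.trans hw hΩcpt hst₂)
    have h3 := intervalIntegral.integral_add_adjacent_intervals
      ((ht.mono hs).intervalIntegrable hΩcpt hw)
      (((ht.mono hs).intervalIntegrable hΩcpt hw).symm.trans (ht.intervalIntegrable hΩcpt hw))
    have h4 : ∫ t in (0:ℝ)..T, w (yT T t) (uT T t) = valueFn f f0 Ω T x z - T * vbar := by
      rw [hwv, ← hval]
      exact integral_sub_const vbar (ht.intervalIntegrable hΩcpt hf0.continuous)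
    linarith [abs_lt.1 hc₁, abs_lt.1 hc₂]
  · intro l hl
    obtain ⟨ε, hε, hlε⟩ : ∃ ε > 0, vInf f Ω w x + vInf (fun a b => -f a b) Ω w z + 2 * ε < l :=
      ⟨(l - (vInf f Ω w x + vInf (fun a b => -f a b) Ω w z)) / 4, by linarith, by linarith⟩
    obtain ⟨τ₁, c₁, hst₁, hc₁⟩ :=
      exists_steers_of_tendsto hw hΩcpt hα hreach_f hDf htraj_f hcstf hoptf.2.2 hε
    obtain ⟨τ₂, c₂, hst₂, hc₂⟩ :=
      exists_steers_of_tendsto hw hΩcpt hα hreach_b hDb htraj_b hcstb hoptb.2.2 hε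
    rw [hoptf.2.1] at hst₁
    rw [hoptb.2.1] at hst₂
    filter_upwards [eventually_gt_atTop 0, eventually_ge_atTop (τ₁ + τ₂)] with T hT hTlarge
    have hmid := steers_const (w := w) hubarΩ hfbar hwbar (T := T - τ₁ - τ₂) (by linarith)
    have hpath := (hst₁.trans hw hΩcpt hmid).trans hw hΩcpt hst₂.reverse_neg
    rw [show τ₁ + (T - τ₁ - τ₂) + τ₂ = T by ring, add_zero, hwv] at hpath
    rw [hwv] at hlow
    have := valueFn_le_of_steers hf0.continuous hΩcpt (hlow T hT) hpath
    linarith
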